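/- arXiv:1910.08209 — 2 statements merged into one kernel-verified Lean document; each statement's English description precedes it below -/
import Mathlib

section
/- If δ, u, R are real numbers with 0 < δ ≤ 1/10, u ≥ 2 − 3δ and R ≥ 6^{1/δ}, then |C(R^u, R)| ≥ (δ^w / (w+1)!) · R^u / log R, where w = ⌊u/(1−δ)⌋. -/
/-- `CPR P R` is the set `C(P,R)` of positive integers `n ≤ P` all of whose prime
factors `p` satisfy `√R < p ≤ R`. -/
noncomputable def CPR (P R : ℝ) : Set ℕ :=
  {n | 1 ≤ n ∧ (n : ℝ) ≤ P ∧ ∀ p : ℕ, p.Prime → p ∣ n → Real.sqrt R < p ∧ (p : ℝ) ≤ R}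

theorem Nat.log_factorial_eq_sum_vonMangoldt (N : ℕ) :
    Real.log (N.factorial : ℝ) =
      ∑ d ∈ Finset.Ioc 0 N, ArithmeticFunction.vonMangoldt d * ((N / d : ℕ) : ℝ) := by
  rw [← ArithmeticFunction.sum_Ioc_mul_zeta_eq_sum ArithmeticFunction.vonMangoldt N,
    ArithmeticFunction.vonMangoldt_mul_zeta]
  induction N with
  | zero => simp
  | succ n ih =>
    rw [Finset.sum_Ioc_succ_top (Nat.zero_le n), ← ih, Nat.factorial_succ, Nat.cast_mul,
      Real.log_mul (by positivity) (by positivity), ArithmeticFunction.log_apply]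
    ring

theorem Nat.log_factorial_div_eq_sum_vonMangoldt (N m : ℕ) :
    Real.log ((N / m).factorial : ℝ) =
      ∑ d ∈ Finset.Ioc 0 N, ArithmeticFunction.vonMangoldt d * ((N / d / m : ℕ) : ℝ) := by
  rw [Nat.log_factorial_eq_sum_vonMangoldt]
  refine Finset.sum_subset_zero_on_sdiff
    (Finset.Ioc_subset_Ioc_right (Nat.div_le_self N m)) (fun d hd => ?_) (fun d _ => ?_)
  · simp only [Finset.mem_sdiff, Finset.mem_Ioc, not_and, not_le] at hd
    rw [Nat.div_div_eq_div_mul, mul_comm d m, ← Nat.div_div_eq_div_mul,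
      Nat.div_eq_of_lt (hd.2 hd.1.1)]
    simp
  · rw [Nat.div_div_eq_div_mul, Nat.div_div_eq_div_mul, mul_comm d m]

/-- The combination `log ((N! (N/30)!) / ((N/2)! (N/3)! (N/5)!))` used by Chebyshev. -/
noncomputable def chebyshevSum (N : ℕ) : ℝ :=
  Real.log (N.factorial : ℝ) - Real.log ((N / 2).factorial : ℝ) -
    Real.log ((N / 3).factorial : ℝ) - Real.log ((N / 5).factorial : ℝ) +
      Real.log ((N / 30).factorial : ℝ)

theorem chebyshevSum_eq (N : ℕ) :
    chebyshevSum N = ∑ d ∈ Finset.Ioc 0 N, ArithmeticFunction.vonMangoldt d *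
      (((N / d : ℕ) : ℝ) - ((N / d / 2 : ℕ) : ℝ) - ((N / d / 3 : ℕ) : ℝ) -
        ((N / d / 5 : ℕ) : ℝ) + ((N / d / 30 : ℕ) : ℝ)) := by
  rw [chebyshevSum, Nat.log_factorial_eq_sum_vonMangoldt]
  simp only [Nat.log_factorial_div_eq_sum_vonMangoldt, mul_sub, mul_add, Finset.sum_sub_distrib,
    Finset.sum_add_distrib]

theorem chebyshevSum_le_psi (N : ℕ) : chebyshevSum N ≤ Chebyshev.psi N := by
  rw [chebyshevSum_eq, Chebyshev.psi, Nat.floor_natCast]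
  refine Finset.sum_le_sum fun d _ =>
    mul_le_of_le_one_right ArithmeticFunction.vonMangoldt_nonneg ?_
  have h : N / d + N / d / 30 ≤ N / d / 2 + N / d / 3 + N / d / 5 + 1 := by omega
  have h' : ((N / d : ℕ) : ℝ) + ((N / d / 30 : ℕ) : ℝ) ≤
      ((N / d / 2 : ℕ) : ℝ) + ((N / d / 3 : ℕ) : ℝ) + ((N / d / 5 : ℕ) : ℝ) + 1 := by
    exact_mod_cast h
  linarith

theorem psi_sub_psi_div_six_le_chebyshevSum (N : ℕ) :
    Chebyshev.psi N - Chebyshev.psi ((N / 6 : ℕ) : ℝ) ≤ chebyshevSum N := by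
  rw [chebyshevSum_eq, Chebyshev.psi, Chebyshev.psi, Nat.floor_natCast, Nat.floor_natCast,
    sub_le_iff_le_add, ← Finset.sum_sdiff (Finset.Ioc_subset_Ioc_right (Nat.div_le_self N 6)),
    ← Finset.sum_sdiff (Finset.Ioc_subset_Ioc_right (Nat.div_le_self N 6))]
  refine add_le_add ?_ ?_ |>.trans (add_le_add_left (le_add_of_nonneg_right ?_) _)
  rotate_left 2
  · refine Finset.sum_nonneg fun d _ => mul_nonneg ArithmeticFunction.vonMangoldt_nonneg ?_
    have h : N / d / 2 + N / d / 3 + N / d / 5 ≤ N / d + N / d / 30 := by omega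
    have h' : ((N / d / 2 : ℕ) : ℝ) + ((N / d / 3 : ℕ) : ℝ) + ((N / d / 5 : ℕ) : ℝ) ≤
        ((N / d : ℕ) : ℝ) + ((N / d / 30 : ℕ) : ℝ) := by exact_mod_cast h
    linarith
  · refine Finset.sum_le_sum fun d hd =>
      le_mul_of_one_le_right ArithmeticFunction.vonMangoldt_nonneg ?_
    simp only [Finset.mem_sdiff, Finset.mem_Ioc, not_and, not_le] at hd
    have h1 : 1 ≤ N / d := Nat.div_pos hd.1.2 hd.1.1
    have h2 : N / d < 6 := by
      rw [Nat.div_lt_iff_lt_mul hd.1.1]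
      have := hd.2 hd.1.1
      rw [Nat.div_lt_iff_lt_mul (by norm_num)] at this
      linarith
    have h : N / d / 2 + N / d / 3 + N / d / 5 + 1 ≤ N / d + N / d / 30 := by omega
    have h' : ((N / d / 2 : ℕ) : ℝ) + ((N / d / 3 : ℕ) : ℝ) + ((N / d / 5 : ℕ) : ℝ) + 1 ≤
        ((N / d : ℕ) : ℝ) + ((N / d / 30 : ℕ) : ℝ) := by exact_mod_cast h
    linarith
  · rfl

theorem Real.log_factorial_floor_le {x : ℝ} (hx : 1 ≤ x) :
    Real.log (⌊x⌋₊.factorial : ℝ) ≤ x * Real.log x - x + Real.log x / 2 + 1 := by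
  have hn : 1 ≤ ⌊x⌋₊ := (Nat.one_le_floor_iff x).2 hx
  have hnx : (⌊x⌋₊ : ℝ) ≤ x := Nat.floor_le (by linarith)
  generalize ⌊x⌋₊ = n at hn hnx
  have hn' : (1 : ℝ) ≤ n := by exact_mod_cast hn
  obtain ⟨m, rfl⟩ : ∃ m, n = m + 1 := ⟨n - 1, by omega⟩
  have h := Stirling.log_stirlingSeq'_antitone (Nat.zero_le m)
  simp only [Function.comp, Nat.succ_eq_add_one, zero_add] at h
  rw [Stirling.log_stirlingSeq_formula, Stirling.stirlingSeq_one,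
    Real.log_div (Real.exp_ne_zero 1) (by positivity), Real.log_exp, Real.log_sqrt (by norm_num),
    Real.log_mul (by norm_num) (by positivity), Real.log_div (by positivity) (Real.exp_ne_zero 1),
    Real.log_exp] at h
  generalize ((m + 1 : ℕ) : ℝ) = y at *
  have h1 : Real.log y ≤ Real.log x := Real.log_le_log (by linarith) hnx
  have h2 : x * (Real.log y - Real.log x) ≤ y - x := by
    rw [← Real.log_div (by positivity) (by positivity)]
    have := Real.log_le_sub_one_of_pos (x := y / x) (by positivity)
    calc x * Real.log (y / x) ≤ x * (y / x - 1) := by gcongr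
      _ = y - x := by field_simp
  have h3 : 0 ≤ (x - y) * Real.log y :=
    mul_nonneg (by linarith) (Real.log_nonneg hn')
  linarith

theorem Real.le_log_factorial_floor {x : ℝ} (hx : 1 ≤ x) :
    x * Real.log x - x - Real.log x / 2 + 1 / 2 ≤ Real.log (⌊x⌋₊.factorial : ℝ) := by
  have hn : 1 ≤ ⌊x⌋₊ := (Nat.one_le_floor_iff x).2 hx
  have hnx : (⌊x⌋₊ : ℝ) ≤ x := Nat.floor_le (by linarith)
  have hxn : x < (⌊x⌋₊ : ℝ) + 1 := Nat.lt_floor_add_one x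
  have h := Stirling.le_log_factorial_stirling (n := ⌊x⌋₊) (by omega)
  generalize ⌊x⌋₊ = n at *
  have hn' : (1 : ℝ) ≤ n := by exact_mod_cast hn
  have hpi : 1.8 ≤ Real.log (2 * Real.pi) := by
    have h1 : Real.log (5 ^ 2 / 2 ^ 2) ≤ Real.log (2 * Real.pi) :=
      Real.log_le_log (by norm_num) (by linarith [Real.pi_gt_d2])
    rw [Real.log_div (by norm_num) (by norm_num), Real.log_pow, Real.log_pow] at h1
    push_cast at h1
    linarith [Real.log_five_gt_d9, Real.log_two_lt_d9]
  generalize (n : ℝ) = y at *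
  have h1 : Real.log x ≤ Real.log y + Real.log 2 := by
    rw [← Real.log_mul (by positivity) (by norm_num)]
    exact Real.log_le_log (by linarith) (by linarith)
  have h2 : y * (Real.log x - Real.log y) ≤ x - y := by
    rw [← Real.log_div (by positivity) (by positivity)]
    have := Real.log_le_sub_one_of_pos (x := x / y) (by positivity)
    calc y * Real.log (x / y) ≤ y * (x / y - 1) := by gcongr
      _ = x - y := by field_simp
  have h3 : 0 ≤ Real.log x := Real.log_nonneg hx
  have h4 : (x - y) * Real.log x ≤ Real.log x := mul_le_of_le_one_left h3 (by linarith)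
  nlinarith [Real.log_two_lt_d9]

theorem log_thirty : Real.log 30 = Real.log 2 + Real.log 3 + Real.log 5 := by
  rw [← Real.log_mul (by norm_num) (by norm_num), ← Real.log_mul (by norm_num) (by norm_num)]
  norm_num

theorem le_chebyshevSum {x : ℝ} (hx : 30 ≤ x) :
    0.9212 * x - 5 / 2 * Real.log x ≤ chebyshevSum ⌊x⌋₊ := by
  have h1 := Real.le_log_factorial_floor (x := x) (by linarith)
  have h2 := Real.log_factorial_floor_le (x := x / 2) (by linarith)
  have h3 := Real.log_factorial_floor_le (x := x / 3) (by linarith)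
  have h5 := Real.log_factorial_floor_le (x := x / 5) (by linarith)
  have h30 := Real.le_log_factorial_floor (x := x / 30) (by linarith)
  rw [Real.log_div (by positivity) (by norm_num)] at h2 h3 h5 h30
  rw [log_thirty] at h30
  rw [Nat.floor_div_ofNat] at h2 h3 h5 h30
  rw [chebyshevSum]
  have := Real.log_two_gt_d9
  have := Real.log_three_gt_d9
  have := Real.log_five_gt_d9
  have hc : 0.9212 ≤ 7 / 15 * Real.log 2 + 3 / 10 * Real.log 3 + 1 / 6 * Real.log 5 := by
    linarith
  have := mul_le_mul_of_nonneg_left hc (by linarith : 0 ≤ x)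
  linarith

theorem chebyshevSum_le {x : ℝ} (hx : 30 ≤ x) :
    chebyshevSum ⌊x⌋₊ ≤ 0.9213 * x + 5 / 2 * Real.log x - 2 := by
  have h1 := Real.log_factorial_floor_le (x := x) (by linarith)
  have h2 := Real.le_log_factorial_floor (x := x / 2) (by linarith)
  have h3 := Real.le_log_factorial_floor (x := x / 3) (by linarith)
  have h5 := Real.le_log_factorial_floor (x := x / 5) (by linarith)
  have h30 := Real.log_factorial_floor_le (x := x / 30) (by linarith)
  rw [Real.log_div (by positivity) (by norm_num)] at h2 h3 h5 h30
  rw [log_thirty] at h30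
  rw [Nat.floor_div_ofNat] at h2 h3 h5 h30
  rw [chebyshevSum]
  have := Real.log_two_lt_d9
  have := Real.log_three_lt_d9
  have := Real.log_five_lt_d9
  have := Real.log_two_gt_d9
  have := Real.log_three_gt_d9
  have := Real.log_five_gt_d9
  have hc : 7 / 15 * Real.log 2 + 3 / 10 * Real.log 3 + 1 / 6 * Real.log 5 ≤ 0.9213 := by
    linarith
  have := mul_le_mul_of_nonneg_left hc (by linarith : 0 ≤ x)
  linarith

theorem lcmUpto_succ (n : ℕ) : Nat.lcmUpto (n + 1) = Nat.lcm (Nat.lcmUpto n) (n + 1) := by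
  rw [Nat.lcmUpto, ← Finset.insert_Icc_right_eq_Icc_add_one (by omega), Finset.lcm_insert]
  exact Nat.lcm_comm _ _

theorem lcmUpto_mul_pow_le : ∀ n ≤ 150, Nat.lcmUpto n * 10 ^ n ≤ 33 ^ n := by
  decide +kernel

theorem psi_natCast_le (N : ℕ) : Chebyshev.psi N ≤ 1.2 * N := by
  induction N using Nat.strong_induction_on with
  | _ N ih =>
  rcases le_or_gt N 150 with hN | hN
  · rw [Chebyshev.psi_eq_log_lcmUpto]
    have h : (Nat.lcmUpto N : ℝ) * 10 ^ N ≤ 33 ^ N := by exact_mod_cast lcmUpto_mul_pow_le N hN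
    have h0 : (0 : ℝ) < Nat.lcmUpto N := by exact_mod_cast Nat.lcmUpto_pos N
    have h1 := Real.log_le_log (by positivity) h
    rw [Real.log_mul (by positivity) (by positivity), Real.log_pow, Real.log_pow] at h1
    have h2 : Real.log 33 ≤ Real.log 10 + 1.2 := by
      rw [← sub_le_iff_le_add', ← Real.log_div (by norm_num) (by norm_num),
        Real.log_le_iff_le_exp (by norm_num)]
      have := Real.add_one_le_exp (0.2 : ℝ)
      have h3 := Real.exp_one_gt_d9
      rw [show (1.2 : ℝ) = 1 + 0.2 by norm_num, Real.exp_add]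
      have := Real.quadratic_le_exp_of_nonneg (x := 0.2) (by norm_num)
      nlinarith
    nlinarith [Nat.cast_nonneg (α := ℝ) N]
  · have h1 := psi_sub_psi_div_six_le_chebyshevSum N
    have hN' : (150 : ℝ) < N := by exact_mod_cast hN
    have h2 := chebyshevSum_le (x := N) (by linarith)
    rw [Nat.floor_natCast] at h2
    have h3 := ih (N / 6) (by omega)
    have h4 : ((N / 6 : ℕ) : ℝ) ≤ N / 6 := by exact_mod_cast Nat.cast_div_le
    have h5 : Real.log N ≤ N / 128 - 1 + 7 * Real.log 2 := by
      have := Real.log_le_sub_one_of_pos (x := (N : ℝ) / 2 ^ 7) (by positivity)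
      rw [Real.log_div (by positivity) (by norm_num), Real.log_pow] at this
      push_cast at this
      linarith
    linarith [Real.log_two_lt_d9]

theorem psi_le_mul {x : ℝ} (hx : 0 ≤ x) : Chebyshev.psi x ≤ 1.2 * x := by
  rw [Chebyshev.psi_eq_psi_coe_floor]
  linarith [psi_natCast_le ⌊x⌋₊, Nat.floor_le hx]

theorem theta_le_mul {x : ℝ} (hx : 0 ≤ x) : Chebyshev.theta x ≤ 1.2 * x :=
  (Chebyshev.theta_le_psi x).trans (psi_le_mul hx)

theorem mul_le_theta {x : ℝ} (hx : 7776 ≤ x) : 0.89 * x ≤ Chebyshev.theta x := by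
  have h0 : 0 ≤ x := by linarith
  have h1 := Chebyshev.psi_sub_theta_le_psi_add_psi_add_psi x
  have h2 := psi_le_mul (Real.rpow_nonneg h0 (2 : ℝ)⁻¹)
  have h3 := psi_le_mul (Real.rpow_nonneg h0 (3 : ℝ)⁻¹)
  have h5 := psi_le_mul (Real.rpow_nonneg h0 (5 : ℝ)⁻¹)
  have h6 := (le_chebyshevSum (x := x) (by linarith)).trans (chebyshevSum_le_psi _)
  rw [← Chebyshev.psi_eq_psi_coe_floor] at h6
  set a := x ^ (2 : ℝ)⁻¹ with ha
  have e2 : a ≤ x / 88 := by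
    rw [ha, Real.rpow_inv_le_iff_of_pos h0 (by positivity) (by norm_num), Real.rpow_two]
    nlinarith
  have e3 : x ^ (3 : ℝ)⁻¹ ≤ x / 384 := by
    rw [Real.rpow_inv_le_iff_of_pos h0 (by positivity) (by norm_num)]
    rw [show (3 : ℝ) = ((3 : ℕ) : ℝ) by norm_num, Real.rpow_natCast]
    have : (7776 : ℝ) ^ 2 ≤ x ^ 2 := by gcongr
    nlinarith
  have e5 : x ^ (5 : ℝ)⁻¹ ≤ x / 1296 := by
    rw [Real.rpow_inv_le_iff_of_pos h0 (by positivity) (by norm_num)]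
    rw [show (5 : ℝ) = ((5 : ℕ) : ℝ) by norm_num, Real.rpow_natCast]
    have : (7776 : ℝ) ^ 4 ≤ x ^ 4 := by gcongr
    nlinarith
  have h7 : Real.log x ≤ x / 8192 - 1 + 13 * Real.log 2 := by
    have := Real.log_le_sub_one_of_pos (x := x / 2 ^ 13) (by positivity)
    rw [Real.log_div (by positivity) (by norm_num), Real.log_pow] at this
    push_cast at this
    linarith
  linarith [Real.log_two_lt_d9]

open MeasureTheory in
/-- A lower bound by partial summation for a weighted sum of values of a decreasing function. -/
theorem integral_mul_le_sum_mul_integral {ι : Type*} (s : Finset ι) (w x : ι → ℝ) {a b : ℝ}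
    (hab : a ≤ b) (hx : ∀ i ∈ s, x i ∈ Set.Icc a b) {G h : ℝ → ℝ}
    (hG : ContinuousOn G (Set.Icc a b)) (hh : ContinuousOn h (Set.Icc a b))
    (hh0 : ∀ t ∈ Set.Icc a b, 0 ≤ h t)
    (hGw : ∀ t ∈ Set.Icc a b, G t ≤ ∑ i ∈ s with x i ≤ t, w i) :
    ∫ t in a..b, G t * h t ≤ ∑ i ∈ s, w i * ∫ t in x i..b, h t := by
  have hint : ∀ i, IntervalIntegrable ((Set.Ici (x i)).indicator h) volume a b := fun i => by
    rw [intervalIntegrable_iff_integrableOn_Icc_of_le hab]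
    exact (hh.integrableOn_Icc).indicator measurableSet_Ici
  have h1 : ∀ i ∈ s, ∫ t in x i..b, h t = ∫ t in a..b, (Set.Ici (x i)).indicator h t := by
    intro i hi
    rw [intervalIntegral.integral_of_le hab, intervalIntegral.integral_of_le (hx i hi).2,
      ← integral_Icc_eq_integral_Ioc, ← integral_Icc_eq_integral_Ioc,
      setIntegral_indicator measurableSet_Ici]
    congr 2
    ext t
    have := (hx i hi).1
    simp only [Set.mem_Icc, Set.mem_inter_iff, Set.mem_Ici]
    grind
  rw [Finset.sum_congr rfl fun i hi => by rw [h1 i hi, ← intervalIntegral.integral_const_mul],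
    ← intervalIntegral.integral_finsetSum fun i _ => (hint i).const_mul _]
  refine intervalIntegral.integral_mono_on hab ?_ ?_ fun t ht => ?_
  · exact ContinuousOn.intervalIntegrable_of_Icc hab (hG.mul hh)
  · rw [show (fun t => ∑ i ∈ s, w i * (Set.Ici (x i)).indicator h t) =
      ∑ i ∈ s, fun t => w i * (Set.Ici (x i)).indicator h t by ext t; simp]
    exact IntervalIntegrable.sum _ fun i _ => (hint i).const_mul _
  · calc G t * h t ≤ (∑ i ∈ s with x i ≤ t, w i) * h t :=
          mul_le_mul_of_nonneg_right (hGw t ht) (hh0 t ht)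
      _ = _ := by
          rw [Finset.sum_filter, Finset.sum_mul]
          refine Finset.sum_congr rfl fun i _ => ?_
          by_cases hi : x i ≤ t <;> simp [hi, Set.indicator]

/-- The primes `p` with `y < p ≤ z`. -/
noncomputable def primesIoc (y z : ℝ) : Finset ℕ :=
  (Finset.Ioc ⌊y⌋₊ ⌊z⌋₊).filter Nat.Prime

theorem mem_primesIoc {y z : ℝ} (hy : 0 ≤ y) (hz : 0 ≤ z) {p : ℕ} :
    p ∈ primesIoc y z ↔ p.Prime ∧ y < p ∧ (p : ℝ) ≤ z := by
  rw [primesIoc, Finset.mem_filter, Finset.mem_Ioc, Nat.floor_lt hy, Nat.le_floor_iff hz]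
  tauto

theorem sum_log_primesIoc {y z : ℝ} (hyz : y ≤ z) :
    ∑ p ∈ primesIoc y z, Real.log p = Chebyshev.theta z - Chebyshev.theta y := by
  rw [eq_sub_iff_add_eq, Chebyshev.theta, Chebyshev.theta, primesIoc, add_comm,
    ← Finset.sum_union]
  · rw [← Finset.filter_union, Finset.Ioc_union_Ioc_eq_Ioc (Nat.zero_le _) (Nat.floor_mono hyz)]
  · refine Finset.disjoint_filter_filter ?_
    rw [Finset.disjoint_left]
    intro p
    simp only [Finset.mem_Ioc]
    omega

theorem le_sum_log_div_primesIoc {y z : ℝ} (hy : 7776 ≤ y) (hyz : y ≤ z) :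
    0.89 * Real.log (z / y) - 0.31 ≤ ∑ p ∈ primesIoc y z, Real.log p / p := by
  have hy0 : 0 < y := by linarith
  have hz0 : 0 < z := by linarith
  have hmem : ∀ {t}, y ≤ t → ∀ p ∈ primesIoc y t, y < p ∧ (p : ℝ) ≤ t := fun hyt p hp =>
    ((mem_primesIoc hy0.le (hy0.le.trans hyt)).1 hp).2
  have hinv : ∀ c, 0 < c → c ≤ z → ∫ t in c..z, (t ^ 2)⁻¹ = 1 / c - 1 / z := by
    intro c hc hcz
    rw [intervalIntegral.integral_eq_sub_of_hasDerivAt (f := fun t => -t⁻¹)]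
    · simp only [one_div]; ring
    · intro t ht
      rw [Set.uIcc_of_le hcz] at ht
      have : t ≠ 0 := by linarith [ht.1]
      have h := (hasDerivAt_inv this).neg
      rw [neg_neg] at h
      exact h
    · refine ContinuousOn.intervalIntegrable_of_Icc hcz ?_
      refine ContinuousOn.inv₀ (by fun_prop) fun t ht => ?_
      have : t ≠ 0 := by linarith [ht.1]
      positivity
  have key := integral_mul_le_sum_mul_integral (primesIoc y z) (fun p : ℕ => Real.log p)
    (fun p : ℕ => (p : ℝ)) hyz (fun p hp => ⟨(hmem hyz p hp).1.le, (hmem hyz p hp).2⟩)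
    (G := fun t => 0.89 * t - 1.2 * y) (h := fun t => (t ^ 2)⁻¹) (by fun_prop)
    (ContinuousOn.inv₀ (by fun_prop) fun t ht => by
      have : t ≠ 0 := by linarith [ht.1]
      positivity)
    (fun t _ => by positivity)
    (fun t ht => by
      have h1 : (primesIoc y z).filter (fun p : ℕ => (p : ℝ) ≤ t) = primesIoc y t := by
        ext p
        rw [Finset.mem_filter, mem_primesIoc hy0.le hz0.le,
          mem_primesIoc hy0.le (hy0.le.trans ht.1)]
        have := ht.2
        constructor
        · rintro ⟨⟨h1, h2, -⟩, h3⟩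
          exact ⟨h1, h2, h3⟩
        · rintro ⟨h1, h2, h3⟩
          exact ⟨⟨h1, h2, h3.trans this⟩, h3⟩
      rw [h1, sum_log_primesIoc ht.1]
      linarith [mul_le_theta (x := t) (by linarith [ht.1]), theta_le_mul hy0.le])
  have hint : ∫ t in y..z, (0.89 * t - 1.2 * y) * (t ^ 2)⁻¹ =
      0.89 * Real.log (z / y) - 1.2 * y * (1 / y - 1 / z) := by
    rw [← hinv y hy0 hyz, ← integral_inv_of_pos hy0 hz0, ← intervalIntegral.integral_const_mul,
      ← intervalIntegral.integral_const_mul, ← intervalIntegral.integral_sub]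
    · refine intervalIntegral.integral_congr fun t ht => ?_
      rw [Set.uIcc_of_le hyz] at ht
      have : t ≠ 0 := by linarith [ht.1]
      field_simp
    · refine ContinuousOn.intervalIntegrable_of_Icc hyz (ContinuousOn.mul (by fun_prop) ?_)
      refine ContinuousOn.inv₀ (by fun_prop) fun t ht => ?_
      linarith [ht.1]
    · refine ContinuousOn.intervalIntegrable_of_Icc hyz (ContinuousOn.mul (by fun_prop) ?_)
      refine ContinuousOn.inv₀ (by fun_prop) fun t ht => ?_
      have : t ≠ 0 := by linarith [ht.1]
      positivity
  have hsum : ∑ p ∈ primesIoc y z, Real.log p / p =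
      (Chebyshev.theta z - Chebyshev.theta y) / z +
        ∑ p ∈ primesIoc y z, Real.log p * ∫ t in (p : ℝ)..z, (t ^ 2)⁻¹ := by
    rw [← sum_log_primesIoc hyz, Finset.sum_div, ← Finset.sum_add_distrib]
    refine Finset.sum_congr rfl fun p hp => ?_
    have h := hmem hyz p hp
    rw [hinv p (by linarith) h.2]
    ring
  have hb : 0.89 - 1.2 * y / z ≤ (Chebyshev.theta z - Chebyshev.theta y) / z := by
    rw [le_div_iff₀ hz0, sub_mul, div_mul_cancel₀ _ hz0.ne']
    linarith [mul_le_theta (x := z) (by linarith), theta_le_mul hy0.le]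
  rw [hint] at key
  rw [hsum]
  have : 1.2 * y * (1 / y - 1 / z) = 1.2 - 1.2 * y / z := by field_simp
  linarith

open Classical in
/-- The positive integers `n ≤ x` having exactly `k` prime factors counted with multiplicity,
all of them in `(√R, R]`. -/
noncomputable def roughFinset (R : ℝ) (k : ℕ) (x : ℝ) : Finset ℕ :=
  (Finset.Icc 1 ⌊x⌋₊).filter fun n => ArithmeticFunction.cardFactors n = k ∧
    ∀ p : ℕ, p.Prime → p ∣ n → Real.sqrt R < p ∧ (p : ℝ) ≤ R

theorem mem_roughFinset {R x : ℝ} (hx : 0 ≤ x) {k n : ℕ} :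
    n ∈ roughFinset R k x ↔ (1 ≤ n ∧ (n : ℝ) ≤ x) ∧ ArithmeticFunction.cardFactors n = k ∧
      ∀ p : ℕ, p.Prime → p ∣ n → Real.sqrt R < p ∧ (p : ℝ) ≤ R := by
  classical
  rw [roughFinset, Finset.mem_filter, Finset.mem_Icc, Nat.le_floor_iff hx]

theorem sum_card_roughFinset_div_le {R x : ℝ} (hx : 0 ≤ x) (k : ℕ) (P : Finset ℕ)
    (hP : ∀ p ∈ P, p.Prime ∧ Real.sqrt R < p ∧ (p : ℝ) ≤ R) :
    ∑ p ∈ P, (roughFinset R k (x / p)).card ≤ (k + 1) * (roughFinset R (k + 1) x).card := by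
  classical
  rw [← Finset.card_sigma]
  refine Finset.card_le_mul_card_image_of_maps_to (f := fun q : (_ : ℕ) × ℕ => q.1 * q.2)
    ?_ _ ?_
  · rintro ⟨p, m⟩ hpm
    rw [Finset.mem_sigma] at hpm
    obtain ⟨hp, hm⟩ := hpm
    obtain ⟨hpp, hp1, hp2⟩ := hP p hp
    rw [mem_roughFinset (by positivity)] at hm
    obtain ⟨⟨hm1, hmx⟩, hm2, hm3⟩ := hm
    have hp0 : (0 : ℝ) < p := by exact_mod_cast hpp.pos
    rw [mem_roughFinset hx]
    refine ⟨⟨Nat.mul_pos hpp.pos hm1, ?_⟩, ?_, ?_⟩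
    · rw [le_div_iff₀ hp0] at hmx
      push_cast
      linarith
    · rw [ArithmeticFunction.cardFactors_mul hpp.ne_zero (by omega),
        ArithmeticFunction.cardFactors_apply_prime hpp, hm2, add_comm]
    · intro q hq hqd
      rcases (Nat.Prime.dvd_mul hq).1 hqd with h | h
      · rw [(Nat.prime_dvd_prime_iff_eq hq hpp).1 h]
        exact ⟨hp1, hp2⟩
      · exact hm3 q hq h
  · intro n hn
    rw [mem_roughFinset hx] at hn
    calc _ ≤ n.primeFactors.card := by
          refine Finset.card_le_card_of_injOn (fun q => q.1) ?_ ?_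
          · rintro ⟨p, m⟩ hq
            simp only [Finset.coe_filter, Finset.mem_sigma, Set.mem_ofPred_eq] at hq
            rw [Finset.mem_coe, Nat.mem_primeFactors]
            exact ⟨(hP p hq.1.1).1, Dvd.intro m hq.2, by omega⟩
          · rintro ⟨p, m⟩ hq ⟨p', m'⟩ hq' h
            simp only [Finset.coe_filter, Finset.mem_sigma, Set.mem_ofPred_eq] at hq hq' h
            subst h
            have : m = m' :=
              Nat.eq_of_mul_eq_mul_left (hP p hq.1.1).1.pos (hq.2.trans hq'.2.symm)
            rw [this]
      _ ≤ k + 1 := by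
          rw [← hn.2.1, ArithmeticFunction.cardFactors_apply]
          exact List.toFinset_card_le _

/-- The normalized number `k! * #(roughFinset R k x) * log R / x` at `x = R ^ (k - T)`. -/
noncomputable def roughDensity (R : ℝ) (k : ℕ) (T : ℝ) : ℝ :=
  k.factorial * (roughFinset R k (R ^ ((k : ℝ) - T))).card * Real.log R / R ^ ((k : ℝ) - T)

theorem sum_roughDensity_le {R : ℝ} (hR : 1 < R) (k : ℕ) (T : ℝ) (P : Finset ℕ)
    (hP : ∀ p ∈ P, p.Prime ∧ Real.sqrt R < p ∧ (p : ℝ) ≤ R) :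
    ∑ p ∈ P, (1 / p : ℝ) * roughDensity R k (T - (1 - Real.log p / Real.log R)) ≤
      roughDensity R (k + 1) T := by
  have hR0 : 0 < R := by linarith
  have hlog : 0 < Real.log R := Real.log_pos hR
  have hterm : ∀ p ∈ P, (1 / p : ℝ) * roughDensity R k (T - (1 - Real.log p / Real.log R)) =
      (k.factorial * Real.log R / R ^ (((k + 1 : ℕ) : ℝ) - T)) *
        ((roughFinset R k (R ^ (((k + 1 : ℕ) : ℝ) - T) / p)).card : ℝ) := by
    intro p hp
    have hp0 : (0 : ℝ) < p := by exact_mod_cast (hP p hp).1.pos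
    have hpow : R ^ ((k : ℝ) - (T - (1 - Real.log p / Real.log R))) =
        R ^ (((k + 1 : ℕ) : ℝ) - T) / p := by
      have : R ^ (Real.log p / Real.log R) = p := by
        rw [Real.rpow_def_of_pos hR0, mul_div_cancel₀ _ hlog.ne', Real.exp_log hp0]
      rw [show (k : ℝ) - (T - (1 - Real.log p / Real.log R)) =
        (((k + 1 : ℕ) : ℝ) - T) - Real.log p / Real.log R by push_cast; ring,
        Real.rpow_sub hR0, this]
    rw [roughDensity, hpow]
    have : R ^ (((k + 1 : ℕ) : ℝ) - T) ≠ 0 := (Real.rpow_pos_of_pos hR0 _).ne'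
    field_simp
  have hx : 0 < R ^ (((k + 1 : ℕ) : ℝ) - T) := Real.rpow_pos_of_pos hR0 _
  have h : ((∑ p ∈ P, (roughFinset R k (R ^ (((k + 1 : ℕ) : ℝ) - T) / p)).card : ℕ) : ℝ) ≤
      (((k + 1) * (roughFinset R (k + 1) (R ^ (((k + 1 : ℕ) : ℝ) - T))).card : ℕ) : ℝ) :=
    Nat.cast_le.2 (sum_card_roughFinset_div_le hx.le k P hP)
  rw [Finset.sum_congr rfl hterm, ← Finset.mul_sum, ← Nat.cast_sum]
  refine (mul_le_mul_of_nonneg_left h (by positivity)).trans_eq ?_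
  rw [roughDensity, Nat.factorial_succ]
  push_cast
  ring

theorem roughDensity_nonneg {R : ℝ} (hR : 1 < R) (k : ℕ) (T : ℝ) : 0 ≤ roughDensity R k T := by
  have := Real.log_pos hR
  have : 0 < R := by linarith
  unfold roughDensity
  positivity

theorem sqrt_le_rpow {R s : ℝ} (hR : 6 ^ 10 ≤ R) (hs : 1 / 2 ≤ s) :
    Real.sqrt R ≤ R ^ s ∧ 7776 ≤ R ^ s := by
  have h1 : Real.sqrt R ≤ R ^ s := by
    rw [Real.sqrt_eq_rpow]
    exact Real.rpow_le_rpow_of_exponent_le (by linarith) hs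
  refine ⟨h1, le_trans ?_ h1⟩
  exact Real.le_sqrt_of_sq_le (by linarith)

theorem roughDensity_succ_ge {R h T a l : ℝ} (hR : 6 ^ 10 ≤ R) {k : ℕ} (hh : 0 ≤ h) (ha : 0 ≤ a)
    (hl : 0 ≤ l) (hal : a + l ≤ 1 / 2)
    (hk : ∀ T' ∈ Set.Icc (T - a - l) (T - a), h ≤ roughDensity R k T') :
    h * (0.89 * l - 0.31 / Real.log R) ≤ roughDensity R (k + 1) T := by
  have hR1 : 1 < R := by linarith
  have hR0 : 0 < R := by linarith
  have hlog : 0 < Real.log R := Real.log_pos hR1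
  obtain ⟨hy1, hy2⟩ := sqrt_le_rpow (s := 1 - a - l) hR (by linarith)
  have hyz : R ^ (1 - a - l) ≤ R ^ (1 - a) :=
    Real.rpow_le_rpow_of_exponent_le hR1.le (by linarith)
  have hzR : R ^ (1 - a) ≤ R := by
    conv_rhs => rw [← Real.rpow_one R]
    exact Real.rpow_le_rpow_of_exponent_le hR1.le (by linarith)
  have hmem := fun p => mem_primesIoc (y := R ^ (1 - a - l)) (z := R ^ (1 - a))
    (by linarith) (by linarith) (p := p)
  have hmass := le_sum_log_div_primesIoc hy2 hyz
  rw [← Real.rpow_sub hR0, Real.log_rpow hR0] at hmass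
  refine le_trans ?_ (sum_roughDensity_le hR1 k T (primesIoc (R ^ (1 - a - l)) (R ^ (1 - a)))
    fun p hp => ?_)
  · calc h * (0.89 * l - 0.31 / Real.log R)
        = h / Real.log R * (0.89 * ((1 - a - (1 - a - l)) * Real.log R) - 0.31) := by
          field_simp
          ring
      _ ≤ h / Real.log R * ∑ p ∈ primesIoc (R ^ (1 - a - l)) (R ^ (1 - a)), Real.log p / p :=
          mul_le_mul_of_nonneg_left hmass (by positivity)
      _ ≤ _ := by
          rw [Finset.mul_sum]
          refine Finset.sum_le_sum fun p hp => ?_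
          obtain ⟨hpp, hp1, hp2⟩ := (hmem p).1 hp
          have hp0 : (0 : ℝ) < p := by exact_mod_cast hpp.pos
          have hlp : Real.log p ≤ (1 - a) * Real.log R := by
            rw [← Real.log_rpow hR0]
            exact Real.log_le_log hp0 hp2
          have hlp' : (1 - a - l) * Real.log R ≤ Real.log p := by
            rw [← Real.log_rpow hR0]
            exact Real.log_le_log (by linarith) hp1.le
          rw [← div_le_iff₀ hlog] at hlp
          rw [← le_div_iff₀ hlog] at hlp'
          have := hk (T - (1 - Real.log p / Real.log R)) ⟨by linarith, by linarith⟩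
          calc h / Real.log R * (Real.log p / p) = 1 / p * (h * (Real.log p / Real.log R)) := by
                ring
            _ ≤ 1 / p * h := by
                gcongr
                exact mul_le_of_le_one_right hh (by linarith)
            _ ≤ _ := by gcongr
  · obtain ⟨hpp, hp1, hp2⟩ := (hmem p).1 hp
    exact ⟨hpp, by linarith, by linarith⟩

theorem sum_log_div_mul_sub_ge {R X : ℝ} (hR : 6 ^ 10 ≤ R) (hX0 : 0 ≤ X)
    (hX : X ≤ Real.log R / 2) :
    0.89 * X ^ 2 / 2 - 0.31 * X ≤ ∑ p ∈ primesIoc (R * Real.exp (-X)) R,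
      Real.log p / p * (X - (Real.log R - Real.log p)) := by
  have hR0 : 0 < R := by linarith
  have hexp : ∀ t ≤ X, 7776 ≤ R * Real.exp (-t) := by
    intro t ht
    refine (sqrt_le_rpow hR le_rfl).2.trans ?_
    rw [Real.rpow_def_of_pos hR0]
    nth_rewrite 2 [← Real.exp_log hR0]
    rw [← Real.exp_add]
    exact Real.exp_le_exp.2 (by linarith)
  have hle : ∀ t, 0 ≤ t → R * Real.exp (-t) ≤ R := fun t ht =>
    mul_le_of_le_one_right hR0.le (Real.exp_le_one_iff.2 (by linarith))
  have hlogexp : ∀ t, Real.log (R * Real.exp (-t)) = Real.log R - t := fun t => by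
    rw [Real.log_mul hR0.ne' (Real.exp_ne_zero _), Real.log_exp, sub_eq_add_neg]
  have hmem : ∀ t p, p ∈ primesIoc (R * Real.exp (-t)) R ↔
      p.Prime ∧ R * Real.exp (-t) < p ∧ (p : ℝ) ≤ R := fun t p =>
    mem_primesIoc (by positivity) hR0.le
  have htau : ∀ t, ∀ p ∈ primesIoc (R * Real.exp (-t)) R,
      Real.log R - Real.log p ∈ Set.Icc 0 t := by
    intro t p hp
    obtain ⟨hpp, hp1, hp2⟩ := (hmem t p).1 hp
    have hp0 : (0 : ℝ) < p := by exact_mod_cast hpp.pos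
    have h1 := Real.log_le_log hp0 hp2
    have h2 := Real.log_le_log (by positivity) hp1.le
    rw [hlogexp] at h2
    exact ⟨by linarith, by linarith⟩
  have key := integral_mul_le_sum_mul_integral (primesIoc (R * Real.exp (-X)) R)
    (fun p : ℕ => Real.log p / p) (fun p : ℕ => Real.log R - Real.log p) hX0
    (fun p hp => htau X p hp) (G := fun t => 0.89 * t - 0.31) (h := fun _ => 1)
    (by fun_prop) (by fun_prop) (fun _ _ => zero_le_one) (fun t ht => by
      have h1 := le_sum_log_div_primesIoc (hexp t ht.2) (hle t ht.1)
      rw [Real.log_div hR0.ne' (by positivity), hlogexp, sub_sub_cancel] at h1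
      refine h1.trans (Finset.sum_le_sum_of_subset_of_nonneg ?_ fun p _ _ => by positivity)
      intro p hp
      rw [Finset.mem_filter]
      refine ⟨?_, (htau t p hp).2⟩
      rw [hmem] at hp ⊢
      refine ⟨hp.1, lt_of_le_of_lt ?_ hp.2.1, hp.2.2⟩
      gcongr
      exact ht.2)
  have hint : ∫ t in (0 : ℝ)..X, (0.89 * t - 0.31) * 1 = 0.89 * X ^ 2 / 2 - 0.31 * X := by
    simp only [mul_one]
    rw [intervalIntegral.integral_sub (Continuous.intervalIntegrable (by fun_prop) _ _)
        (Continuous.intervalIntegrable (by fun_prop) _ _),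
      intervalIntegral.integral_const_mul, integral_id, intervalIntegral.integral_const]
    simp only [smul_eq_mul]
    ring
  rw [hint] at key
  simpa using key

theorem roughDensity_add_two_ge {R h T η : ℝ} (hR : 6 ^ 10 ≤ R) {k : ℕ} (hh : 0 ≤ h)
    (hη : η ≤ 1 / 2) (hη' : 0.31 ≤ 0.89 * (η * Real.log R))
    (hk : ∀ T' ∈ Set.Icc (T - η) T, h ≤ roughDensity R k T') :
    h * (((0.89 * (η * Real.log R) - 0.62) ^ 2 - 0.0961) / 2 / Real.log R ^ 2) ≤
      roughDensity R (k + 2) T := by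
  have hR1 : 1 < R := by linarith
  have hR0 : 0 < R := by linarith
  have hlog : 0 < Real.log R := Real.log_pos hR1
  set X : ℝ := η * Real.log R - 0.31 / 0.89 with hX
  have hX0 : 0 ≤ X := by rw [hX]; linarith
  have hXR : X ≤ Real.log R / 2 := by
    rw [hX]
    nlinarith
  have hmass := sum_log_div_mul_sub_ge hR hX0 hXR
  have hexp : Real.sqrt R ≤ R * Real.exp (-X) := by
    rw [Real.sqrt_eq_rpow, Real.rpow_def_of_pos hR0]
    nth_rewrite 2 [← Real.exp_log hR0]
    rw [← Real.exp_add]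
    exact Real.exp_le_exp.2 (by linarith)
  have hmem := fun p => mem_primesIoc (y := R * Real.exp (-X)) (z := R)
    (by positivity) hR0.le (p := p)
  refine le_trans ?_ (sum_roughDensity_le hR1 (k + 1) T (primesIoc (R * Real.exp (-X)) R)
    fun p hp => ?_)
  · calc h * (((0.89 * (η * Real.log R) - 0.62) ^ 2 - 0.0961) / 2 / Real.log R ^ 2)
        = h * 0.89 / Real.log R ^ 2 * (0.89 * X ^ 2 / 2 - 0.31 * X) := by
          rw [hX]
          field_simp
          ring
      _ ≤ h * 0.89 / Real.log R ^ 2 * ∑ p ∈ primesIoc (R * Real.exp (-X)) R,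
            Real.log p / p * (X - (Real.log R - Real.log p)) :=
          mul_le_mul_of_nonneg_left hmass (by positivity)
      _ ≤ _ := by
          rw [Finset.mul_sum]
          refine Finset.sum_le_sum fun p hp => ?_
          obtain ⟨hpp, hp1, hp2⟩ := (hmem p).1 hp
          have hp0 : (0 : ℝ) < p := by exact_mod_cast hpp.pos
          have hlp : Real.log p ≤ Real.log R := Real.log_le_log hp0 hp2
          have hlp' : Real.log R - X ≤ Real.log p := by
            have := Real.log_le_log (by positivity) hp1.le
            rwa [Real.log_mul hR0.ne' (Real.exp_ne_zero _), Real.log_exp, ← sub_eq_add_neg]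
              at this
          set v := Real.log p / Real.log R with hv
          have hv1 : v ≤ 1 := (div_le_one hlog).2 hlp
          have hvlog : v * Real.log R = Real.log p := div_mul_cancel₀ _ hlog.ne'
          have hvη : 1 - v ≤ η := by
            have : (1 - v) * Real.log R ≤ η * Real.log R := by
              rw [sub_mul, hvlog]
              linarith
            exact le_of_mul_le_mul_right this hlog
          have hv0 : 0 ≤ v := by linarith
          have hstep := roughDensity_succ_ge (k := k) (T := T - (1 - v)) (a := 0)
            (l := η - (1 - v)) hR hh le_rfl (by linarith) (by linarith)
            fun T' hT' => hk T' ⟨by linarith [hT'.1], by linarith [hT'.2]⟩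
          have hnn : 0 ≤ 0.89 * (η - (1 - v)) - 0.31 / Real.log R := by
            rw [sub_nonneg, div_le_iff₀ hlog]
            linarith
          calc h * 0.89 / Real.log R ^ 2 * (Real.log p / p * (X - (Real.log R - Real.log p)))
              = 1 / p * (v * (h * (0.89 * (η - (1 - v)) - 0.31 / Real.log R))) := by
                rw [← hvlog, hX]
                field_simp
                ring
            _ ≤ 1 / p * (h * (0.89 * (η - (1 - v)) - 0.31 / Real.log R)) := by
                exact mul_le_mul_of_nonneg_left
                  (mul_le_of_le_one_left (mul_nonneg hh hnn) hv1) (by positivity)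
            _ ≤ _ := by gcongr
  · obtain ⟨hpp, hp1, hp2⟩ := (hmem p).1 hp
    exact ⟨hpp, by linarith, by linarith⟩

theorem rpow_le_one_div {R t a b : ℝ} (hR : 6 ^ 10 ≤ R) (hta : t ≤ -a / 10) (ha : 0 ≤ a)
    (hb : 0 < b) (hab : b ^ (5 : ℕ) ≤ 6 ^ (5 * a)) : R ^ t ≤ 1 / b := by
  have hR0 : 0 < R := by linarith
  have h1 : b ≤ 6 ^ a := by
    refine le_of_pow_le_pow_left₀ (n := 5) (by norm_num) (by positivity) (hab.trans_eq ?_)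
    rw [← Real.rpow_natCast (6 ^ a) 5, ← Real.rpow_mul (by norm_num)]
    ring_nf
  calc R ^ t ≤ R ^ (-a / 10) := Real.rpow_le_rpow_of_exponent_le (by linarith) hta
    _ = 1 / R ^ (a / 10) := by rw [neg_div, Real.rpow_neg hR0.le, one_div]
    _ ≤ 1 / (6 ^ (10 : ℕ)) ^ (a / 10) := by gcongr
    _ = 1 / 6 ^ a := by
      rw [← Real.rpow_natCast, ← Real.rpow_mul (by norm_num)]
      congr 2
      push_cast
      ring
    _ ≤ 1 / b := by gcongr

theorem mul_one_sub_le_of_le {R T : ℝ} (hR : 6 ^ 10 ≤ R) (hT0 : 0 ≤ T) (hT : T ≤ 0.42) :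
    0.88 * (1 - T) ≤ 0.89 - 1.2 * R ^ (T - 1 / 2) := by
  rcases le_or_gt T 0.2 with h | h
  · have := rpow_le_one_div (t := T - 1 / 2) (a := 3) (b := 216) hR (by linarith) (by norm_num)
      (by norm_num) (by norm_num)
    linarith
  rcases le_or_gt T 0.3 with h | h
  · have := rpow_le_one_div (t := T - 1 / 2) (a := 2) (b := 36) hR (by linarith) (by norm_num)
      (by norm_num) (by norm_num)
    linarith
  rcases le_or_gt T 0.4 with h | h
  · have := rpow_le_one_div (t := T - 1 / 2) (a := 1) (b := 6) hR (by linarith) (by norm_num)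
      (by norm_num) (by norm_num)
    linarith
  · have := rpow_le_one_div (t := T - 1 / 2) (a := 0.8) (b := 4) hR (by linarith) (by norm_num)
      (by norm_num) (by norm_num)
    linarith

theorem roughDensity_one_ge {R T : ℝ} (hR : 6 ^ 10 ≤ R) (hT0 : 0 ≤ T) (hT : T ≤ 0.42) :
    0.88 ≤ roughDensity R 1 T := by
  have hR1 : 1 < R := by linarith
  have hR0 : 0 < R := by linarith
  have hlog : 0 < Real.log R := Real.log_pos hR1
  obtain ⟨hy1, hy2⟩ := sqrt_le_rpow (s := 1 - T) hR (by linarith)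
  set y := R ^ (1 - T) with hy
  have hy0 : 0 < y := by linarith
  have hyR : y ≤ R := by
    conv_rhs => rw [← Real.rpow_one R]
    exact Real.rpow_le_rpow_of_exponent_le hR1.le (by linarith)
  have hsub : primesIoc (Real.sqrt R) y ⊆ roughFinset R 1 y := by
    intro p hp
    obtain ⟨hpp, hp1, hp2⟩ := (mem_primesIoc (Real.sqrt_nonneg R) hy0.le).1 hp
    refine (mem_roughFinset hy0.le).2
      ⟨⟨hpp.one_lt.le, hp2⟩, ArithmeticFunction.cardFactors_apply_prime hpp, fun q hq hqp => ?_⟩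
    rw [(Nat.prime_dvd_prime_iff_eq hq hpp).1 hqp]
    exact ⟨hp1, hp2.trans hyR⟩
  have hcard : ((primesIoc (Real.sqrt R) y).card : ℝ) ≤ (roughFinset R 1 y).card :=
    Nat.cast_le.2 (Finset.card_le_card hsub)
  have hsum : Chebyshev.theta y - Chebyshev.theta (Real.sqrt R) ≤
      (primesIoc (Real.sqrt R) y).card * ((1 - T) * Real.log R) := by
    rw [← sum_log_primesIoc hy1, ← nsmul_eq_mul]
    refine Finset.sum_le_card_nsmul _ _ _ fun p hp => ?_
    obtain ⟨hpp, hp1, hp2⟩ := (mem_primesIoc (Real.sqrt_nonneg R) hy0.le).1 hp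
    rw [← Real.log_rpow hR0]
    exact Real.log_le_log (by exact_mod_cast hpp.pos) hp2
  have hsqrt : Real.sqrt R = y * R ^ (T - 1 / 2) := by
    rw [hy, ← Real.rpow_add hR0, Real.sqrt_eq_rpow]
    congr 1
    ring
  have hth := theta_le_mul (Real.sqrt_nonneg R)
  rw [hsqrt] at hth hsum
  have hth' := mul_le_theta hy2
  have hnum := mul_le_mul_of_nonneg_right (mul_one_sub_le_of_le hR hT0 hT) hy0.le
  have hT1 : 0 < 1 - T := by linarith
  rw [hsqrt] at hcard
  have hfin : 0.88 * (1 - T) * y ≤ (roughFinset R 1 y).card * ((1 - T) * Real.log R) := by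
    refine le_trans ?_ (mul_le_mul_of_nonneg_right hcard (by positivity))
    linarith
  rw [roughDensity, Nat.cast_one, ← hy, le_div_iff₀ hy0, Nat.factorial_one, Nat.cast_one, one_mul]
  refine le_of_mul_le_mul_right ?_ hT1
  linarith

theorem log_six_ge : 1.79 ≤ Real.log 6 := by
  rw [Real.le_log_iff_exp_le (by norm_num)]
  refine le_of_pow_le_pow_left₀ (n := 100) (by norm_num) (by norm_num) ?_
  rw [← Real.exp_nat_mul]
  have : Real.exp ((100 : ℕ) * 1.79) = Real.exp 1 ^ 179 := by
    rw [← Real.exp_nat_mul]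
    norm_num
  rw [this]
  calc Real.exp 1 ^ 179 ≤ 2.7182818286 ^ 179 := by
        gcongr
        exact Real.exp_one_lt_d9.le
    _ ≤ 6 ^ 100 := by norm_num

theorem le_mul_log_of_rpow_le {δ R : ℝ} (hδ : 0 < δ) (hR : (6 : ℝ) ^ (1 / δ) ≤ R) :
    1.79 ≤ δ * Real.log R := by
  have h := Real.log_le_log (by positivity) hR
  rw [Real.log_rpow (by norm_num), one_div, inv_mul_le_iff₀ hδ] at h
  exact log_six_ge.trans h

theorem six_pow_ten_le_of_rpow_le {δ R : ℝ} (hδ : 0 < δ) (hδ₁ : δ ≤ 1 / 10)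
    (hR : (6 : ℝ) ^ (1 / δ) ≤ R) : 6 ^ 10 ≤ R := by
  refine le_trans ?_ hR
  rw [← Real.rpow_natCast]
  refine Real.rpow_le_rpow_of_exponent_le (by norm_num) ?_
  rw [le_div_iff₀ hδ]
  push_cast
  linarith

theorem roughDensity_succ_ge_of_mul_log {δ R c h T a l : ℝ} (hR : 6 ^ 10 ≤ R)
    (hL : 1.79 ≤ δ * Real.log R) {k : ℕ} (hh : 0 ≤ h) (ha : 0 ≤ a) (hl : 0 ≤ l)
    (hal : a + l ≤ 1 / 2) (hc : c ≤ h * (0.89 * l - 0.1732 * δ))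
    (hk : ∀ T', T - a - l ≤ T' → T' ≤ T - a → h ≤ roughDensity R k T') :
    c ≤ roughDensity R (k + 1) T := by
  have hlog : 0 < Real.log R := Real.log_pos (by linarith)
  refine hc.trans (le_trans (mul_le_mul_of_nonneg_left ?_ hh)
    (roughDensity_succ_ge hR hh ha hl hal fun T' hT' => hk T' hT'.1 hT'.2))
  have : 0.31 / Real.log R ≤ 0.1732 * δ := by
    rw [div_le_iff₀ hlog]
    linarith
  linarith

theorem mul_sq_le_of_mul_log {δ D c h m : ℝ} (hD : 0 < D)
    (h2 : c * (δ * D) ^ 2 ≤ h * (((0.89 * (m * (δ * D)) - 0.62) ^ 2 - 0.0961) / 2)) :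
    c * δ ^ 2 ≤ h * (((0.89 * (m * δ * D) - 0.62) ^ 2 - 0.0961) / 2 / D ^ 2) := by
  rw [← mul_div_assoc, le_div_iff₀ (by positivity), mul_assoc m]
  linarith

/-- The main lower bound: for `k ≥ 2` the normalized count is at least `δ ^ (k - 1)` on a long
range of `T`. -/
theorem pow_le_roughDensity {δ R : ℝ} (hδ : 0 < δ) (hδ₁ : δ ≤ 1 / 10) (hR : 6 ^ 10 ≤ R)
    (hL : 1.79 ≤ δ * Real.log R) (k : ℕ) : ∀ T : ℝ, (k + 2) * δ ≤ T → T ≤ 0.42 + 0.33 * (k + 1) →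
      δ ^ (k + 1) ≤ roughDensity R (k + 2) T := by
  have hlog : 0 < Real.log R := Real.log_pos (by linarith)
  have hsingle : ∀ (k : ℕ) (T : ℝ), (k + 3.5) * δ ≤ T → T ≤ 0.42 + 0.33 * (k + 2) →
      (∀ T : ℝ, (k + 2) * δ ≤ T → T ≤ 0.42 + 0.33 * (k + 1) →
        δ ^ (k + 1) ≤ roughDensity R (k + 2) T) → δ ^ (k + 2) ≤ roughDensity R (k + 3) T := by
    intro k T hT1 hT2 ih
    have hpow : 0 < δ ^ (k + 1) := pow_pos hδ _
    have hkδ : (k : ℝ) * δ ≤ k * (1 / 10) := by gcongr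
    have hk0 : (0 : ℝ) ≤ k := k.cast_nonneg
    refine roughDensity_succ_ge_of_mul_log (h := δ ^ (k + 1))
      (a := max 0 (T - (0.42 + 0.33 * (k + 1)))) (l := 1.5 * δ) hR hL hpow.le
      (le_max_left _ _) (by positivity) ?_ ?_ fun T' h1 h2 => ih T' ?_ ?_
    · rw [← le_sub_iff_add_le]
      exact max_le (by linarith) (by linarith)
    · rw [pow_succ δ (k + 1)]
      refine mul_le_mul_of_nonneg_left ?_ hpow.le
      linarith
    · refine le_trans ?_ h1
      rcases max_cases 0 (T - (0.42 + 0.33 * ((k : ℝ) + 1))) with h | h <;> rw [h.1] <;> linarith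
    · linarith [le_max_right 0 (T - (0.42 + 0.33 * ((k : ℝ) + 1)))]
  induction k using Nat.strong_induction_on with
  | _ k ih =>
  intro T hT1 hT2
  match k with
  | 0 =>
    norm_num at hT1 hT2
    simp only [zero_add, pow_one]
    rcases le_or_gt T 0.42 with h | h
    · exact roughDensity_succ_ge_of_mul_log (h := 0.88) (a := 0) (l := 2 * δ) hR hL
        (by norm_num) le_rfl (by positivity) (by linarith) (by linarith)
        fun T' h1 h2 => roughDensity_one_ge hR (by linarith) (by linarith)
    · exact roughDensity_succ_ge_of_mul_log (h := 0.88) (a := T - 0.42) (l := 1.5 * δ) hR hL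
        (by norm_num) (by linarith) (by positivity) (by linarith) (by linarith)
        fun T' h1 h2 => roughDensity_one_ge hR (by linarith) (by linarith)
  | 1 =>
    norm_num at hT1 hT2
    rcases le_or_gt T 0.42 with h | h
    · have h3 := roughDensity_add_two_ge (R := R) (h := 0.88) (T := T) (η := 3 * δ) (k := 1) hR
        (by norm_num) (by linarith) (by linarith)
        fun T' hT' => roughDensity_one_ge hR (by linarith [hT'.1]) (by linarith [hT'.2])
      refine le_trans ?_ h3
      rw [← one_mul (δ ^ _)]
      refine mul_sq_le_of_mul_log hlog ?_
      nlinarith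
    · refine hsingle 0 T ?_ ?_ ?_
      · norm_num
        linarith
      · norm_num
        linarith
      · exact ih 0 one_pos
  | k + 2 =>
    push_cast at hT1 hT2
    have hkδ : (k : ℝ) * δ ≤ k * (1 / 10) := by gcongr
    have hk0 : (0 : ℝ) ≤ k := k.cast_nonneg
    rcases le_or_gt ((k + 4.5) * δ) T with h | h
    · refine hsingle (k + 1) T ?_ ?_ (ih (k + 1) (by omega)) <;> push_cast <;> linarith
    · have hpow : 0 < δ ^ (k + 1) := pow_pos hδ _
      have h3 := roughDensity_add_two_ge (R := R) (h := δ ^ (k + 1)) (T := T) (η := 2 * δ)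
        (k := k + 2) hR hpow.le (by linarith) (by linarith)
        fun T' hT' => ih k (by omega) T' (by linarith [hT'.1]) (by linarith [hT'.2])
      refine le_trans ?_ h3
      rw [show k + 2 + 1 = k + 1 + 2 by ring, pow_add δ (k + 1)]
      refine mul_sq_le_of_mul_log hlog (mul_le_mul_of_nonneg_left ?_ hpow.le)
      nlinarith

theorem roughDensity_two_ge {δ R T : ℝ} (hδ : 0 < δ) (hδ₁ : δ ≤ 1 / 10) (hR : 6 ^ 10 ≤ R)
    (hL : 1.79 ≤ δ * Real.log R) (hT : δ / 2 ≤ T) (hT' : T ≤ 0.42) :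
    0.23 * δ ≤ roughDensity R 2 T :=
  roughDensity_succ_ge_of_mul_log (h := 0.88) (a := 0) (l := δ / 2) hR hL
    (by norm_num) le_rfl (by positivity) (by linarith) (by linarith)
    fun T' h1 h2 => roughDensity_one_ge hR (by linarith) (by linarith)

theorem div_factorial_mul_le_card_CPR {R u c T : ℝ} (hR : 1 < R) {k : ℕ} (hT : (k : ℝ) - T = u)
    (h : c ≤ roughDensity R k T) :
    c / k.factorial * (R ^ u / Real.log R) ≤ (Nat.card (CPR (R ^ u) R) : ℝ) := by
  have hlog : 0 < Real.log R := Real.log_pos hR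
  have hx : 0 < R ^ u := Real.rpow_pos_of_pos (by linarith) _
  have hsub : (roughFinset R k (R ^ u) : Set ℕ) ⊆ CPR (R ^ u) R := fun n hn => by
    obtain ⟨⟨h1, h2⟩, -, h3⟩ := (mem_roughFinset hx.le).1 hn
    exact ⟨h1, h2, h3⟩
  have hfin : (CPR (R ^ u) R).Finite :=
    (Set.finite_Iic ⌊R ^ u⌋₊).subset fun n hn => Nat.le_floor hn.2.1
  have hcard : (roughFinset R k (R ^ u)).card ≤ Nat.card (CPR (R ^ u) R) := by
    rw [← Set.ncard_coe_finset, Nat.card_coe_set_eq]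
    exact Set.ncard_le_ncard hsub hfin
  refine le_trans ?_ (Nat.cast_le.2 hcard)
  rw [roughDensity, hT, le_div_iff₀ hx] at h
  rw [div_mul_div_comm, div_le_iff₀ (by positivity)]
  linarith

/-- **Lemma 2.2, Ford**: if `0 < δ ≤ 1/10`, `u ≥ 2 − 3δ` and `R ≥ 6^{1/δ}`, then
`|C(R^u, R)| ≥ (δ^w/(w+1)!) · R^u/log R` where `w = ⌊u/(1−δ)⌋`. -/
theorem CPR_card_lower_bound (δ u R : ℝ) (hδ₀ : 0 < δ) (hδ₁ : δ ≤ 1/10)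
    (hu : 2 - 3 * δ ≤ u) (hR : (6 : ℝ) ^ (1 / δ) ≤ R) :
    δ ^ (⌊u / (1 - δ)⌋₊) / (Nat.factorial (⌊u / (1 - δ)⌋₊ + 1)) * (R ^ u / Real.log R) ≤
      (Nat.card (CPR (R ^ u) R) : ℝ) := by
  have hR6 := six_pow_ten_le_of_rpow_le hδ₀ hδ₁ hR
  have hL := le_mul_log_of_rpow_le hδ₀ hR
  have hR1 : 1 < R := by linarith
  have hlog : 0 < Real.log R := Real.log_pos hR1
  have hx : 0 < R ^ u := Real.rpow_pos_of_pos (by linarith) _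
  have hd : 0 < 1 - δ := by linarith
  have hw1 : (⌊u / (1 - δ)⌋₊ : ℝ) * (1 - δ) ≤ u := by
    rw [← le_div_iff₀ hd]
    exact Nat.floor_le (div_nonneg (by linarith) hd.le)
  have hw2 : u < (⌊u / (1 - δ)⌋₊ + 1 : ℝ) * (1 - δ) := by
    rw [← div_lt_iff₀ hd]
    exact Nat.lt_floor_add_one _
  generalize ⌊u / (1 - δ)⌋₊ = w at *
  match w with
  | 0 =>
    norm_num at hw2
    linarith
  | 1 =>
    norm_num at hw2
    exact div_factorial_mul_le_card_CPR (T := 2 - u) (k := 2) hR1 (by push_cast; ring)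
      (pow_le_roughDensity hδ₀ hδ₁ hR6 hL 0 _ (by push_cast; linarith) (by push_cast; linarith))
  | 2 =>
    norm_num at hw1 hw2
    rcases le_or_gt u (2 - δ / 2) with h | h
    · refine le_trans ?_ (div_factorial_mul_le_card_CPR (T := 2 - u) (k := 2) hR1
        (by push_cast; ring)
        (roughDensity_two_ge hδ₀ hδ₁ hR6 hL (by linarith) (by linarith)))
      refine mul_le_mul_of_nonneg_right ?_ (by positivity)
      norm_num [Nat.factorial]
      nlinarith
    · exact div_factorial_mul_le_card_CPR (T := 3 - u) (k := 3) hR1 (by push_cast; ring)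
        (pow_le_roughDensity hδ₀ hδ₁ hR6 hL 1 _ (by push_cast; linarith) (by push_cast; linarith))
  | w + 3 =>
    push_cast at hw1 hw2
    have hwδ : (w : ℝ) * δ ≤ w * (1 / 10) := by gcongr
    have hw0 : (0 : ℝ) ≤ w := w.cast_nonneg
    exact div_factorial_mul_le_card_CPR (T := w + 4 - u) (k := w + 4) hR1 (by push_cast; ring)
      (pow_le_roughDensity hδ₀ hδ₁ hR6 hL (w + 2) _ (by push_cast; linarith)
        (by push_cast; linarith))
end

section
/- If u and R are real numbers with R ≥ (2u)³ ≥ 90000, then |C(R^u, R)| ≤ R^u · (2/u)^u. -/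
open Finset Real

theorem theta_natCast_succ (n : ℕ) :
    Chebyshev.theta ((n + 1 : ℕ) : ℝ) =
      Chebyshev.theta (n : ℝ) + if (n + 1).Prime then log ((n + 1 : ℕ) : ℝ) else 0 := by
  simp only [Chebyshev.theta, Nat.floor_natCast, sum_filter]
  rw [sum_Ioc_succ_top (Nat.zero_le n)]

theorem natCast_succ_rpow_sub_one_le (n : ℕ) {η : ℝ} (h0 : 0 < η) (h1 : η ≤ 1) :
    ((n + 1 : ℕ) : ℝ) ^ (η - 1) ≤ (((n + 1 : ℕ) : ℝ) ^ η - (n : ℝ) ^ η) / η := by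
  have hm : (0 : ℝ) < ((n + 1 : ℕ) : ℝ) := by positivity
  set m : ℝ := ((n + 1 : ℕ) : ℝ) with hmdef
  have hm1 : (1 : ℝ) ≤ m := by rw [hmdef]; exact_mod_cast Nat.le_add_left 1 n
  have hinv : m⁻¹ ≤ 1 := inv_le_one_of_one_le₀ hm1
  have hn : (n : ℝ) = m * (1 + -m⁻¹) := by
    rw [mul_add, mul_neg, mul_inv_cancel₀ hm.ne', hmdef]; push_cast; ring
  have hb : (1 + -m⁻¹) ^ η ≤ 1 + η * (-m⁻¹) :=
    rpow_one_add_le_one_add_mul_self (by linarith) h0.le h1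
  have hpos : 0 < m ^ η := rpow_pos_of_pos hm _
  rw [le_div_iff₀ h0, hn, mul_rpow hm.le (by linarith), rpow_sub_one hm.ne', div_eq_mul_inv]
  nlinarith [mul_le_mul_of_nonneg_left hb hpos.le]

/-- Partial summation against Chebyshev's bound `θ x ≤ x log 4`. -/
theorem sum_log_mul_rpow_add_le {η : ℝ} (h0 : 0 < η) (h1 : η ≤ 1) (A : ℕ) {B : ℕ}
    (hB : A + 1 ≤ B) :
    (∑ p ∈ Ioc A B with p.Prime, log p * (p : ℝ) ^ (η - 1)) +
        (log 4 * B - Chebyshev.theta B) * (B : ℝ) ^ (η - 1) ≤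
      log 4 * (((A + 1 : ℕ) : ℝ) ^ η + ((B : ℝ) ^ η - ((A + 1 : ℕ) : ℝ) ^ η) / η) := by
  have hstep (n : ℕ) :
      (∑ p ∈ Ioc n (n + 1) with p.Prime, log p * (p : ℝ) ^ (η - 1)) +
        (log 4 * (n + 1 : ℕ) - Chebyshev.theta (n + 1 : ℕ)) * ((n + 1 : ℕ) : ℝ) ^ (η - 1) =
      (log 4 + (log 4 * n - Chebyshev.theta n)) * ((n + 1 : ℕ) : ℝ) ^ (η - 1) := by
    rw [theta_natCast_succ, sum_filter, sum_Ioc_succ_top le_rfl, Ioc_self, sum_empty]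
    split_ifs <;> push_cast <;> ring
  have hlog : 0 < log 4 := log_pos (by norm_num)
  induction B, hB using Nat.le_induction with
  | base =>
    rw [hstep, sub_self, zero_div, add_zero]
    have hpos : (0 : ℝ) < ((A + 1 : ℕ) : ℝ) := by positivity
    have hg : (((A + 1 : ℕ) : ℝ)) ^ η = ((A + 1 : ℕ) : ℝ) * ((A + 1 : ℕ) : ℝ) ^ (η - 1) := by
      rw [rpow_sub_one hpos.ne']; field_simp
    rw [hg, ← mul_assoc]
    refine mul_le_mul_of_nonneg_right ?_ (rpow_nonneg hpos.le _)
    push_cast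
    linarith [Chebyshev.theta_nonneg (A : ℝ)]
  | succ n hn ih =>
    have hD : 0 ≤ log 4 * n - Chebyshev.theta n := by
      linarith [Chebyshev.theta_le_log4_mul_x (x := (n : ℝ)) (Nat.cast_nonneg n)]
    have hn0 : (0 : ℝ) < n := by exact_mod_cast (by omega : 0 < n)
    have hanti : ((n + 1 : ℕ) : ℝ) ^ (η - 1) ≤ (n : ℝ) ^ (η - 1) :=
      rpow_le_rpow_of_nonpos hn0 (by push_cast; linarith) (by linarith)
    have hsplit : (∑ p ∈ Ioc A (n + 1) with p.Prime, log p * (p : ℝ) ^ (η - 1)) =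
        (∑ p ∈ Ioc A n with p.Prime, log p * (p : ℝ) ^ (η - 1)) +
          ∑ p ∈ Ioc n (n + 1) with p.Prime, log p * (p : ℝ) ^ (η - 1) := by
      simp only [sum_filter]
      rw [sum_Ioc_consecutive _ (by omega) (by omega)]
    rw [hsplit, add_assoc, hstep]
    have h2 := mul_le_mul_of_nonneg_left (natCast_succ_rpow_sub_one_le n h0 h1) hlog.le
    have h3 := mul_le_mul_of_nonneg_left hanti hD
    have h4 : (((n + 1 : ℕ) : ℝ) ^ η - ((A + 1 : ℕ) : ℝ) ^ η) / η =
        ((n : ℝ) ^ η - ((A + 1 : ℕ) : ℝ) ^ η) / η +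
          (((n + 1 : ℕ) : ℝ) ^ η - (n : ℝ) ^ η) / η := by ring
    rw [h4]
    nlinarith

theorem sum_log_mul_rpow_sqrt_le {η R : ℝ} (h0 : 0 < η) (h1 : η ≤ 1) (hR : 4 ≤ R) :
    ∑ p ∈ Ioc ⌊√R⌋₊ ⌊R⌋₊ with p.Prime, log p * (p : ℝ) ^ (η - 1) ≤
      log 4 * ((R ^ η - (√R) ^ η) / η + (√R) ^ η) := by
  have hs2 : 2 ≤ √R := le_sqrt_of_sq_le (by linarith)
  have hsq : √R * √R = R := mul_self_sqrt (by linarith)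
  have hAB : ⌊√R⌋₊ + 1 ≤ ⌊R⌋₊ := by
    apply Nat.le_floor
    push_cast
    nlinarith [Nat.floor_le (sqrt_nonneg R)]
  have hlog : 0 < log 4 := log_pos (by norm_num)
  have hmain := sum_log_mul_rpow_add_le h0 h1 ⌊√R⌋₊ hAB
  have hD : 0 ≤ (log 4 * (⌊R⌋₊ : ℝ) - Chebyshev.theta (⌊R⌋₊ : ℝ)) * (⌊R⌋₊ : ℝ) ^ (η - 1) :=
    mul_nonneg (by
      linarith [Chebyshev.theta_le_log4_mul_x (x := (⌊R⌋₊ : ℝ)) (Nat.cast_nonneg _)])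
      (rpow_nonneg (Nat.cast_nonneg _) _)
  have hB : (⌊R⌋₊ : ℝ) ^ η ≤ R ^ η :=
    rpow_le_rpow (Nat.cast_nonneg _) (Nat.floor_le (by linarith)) h0.le
  have hA : (√R) ^ η ≤ ((⌊√R⌋₊ + 1 : ℕ) : ℝ) ^ η :=
    rpow_le_rpow (sqrt_nonneg _) (by push_cast; exact (Nat.lt_floor_add_one _).le) h0.le
  have hinv : 1 ≤ η⁻¹ := (one_le_inv₀ h0).2 h1
  refine (le_add_of_nonneg_right hD).trans (hmain.trans (mul_le_mul_of_nonneg_left ?_ hlog.le))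
  rw [div_eq_mul_inv, div_eq_mul_inv]
  nlinarith

/-- Rankin's method for the integers up to `P` whose prime factors lie in `s`. -/
theorem card_le_rpow_mul_prod_inv (s : Finset ℕ) {P α : ℝ} (hP : 0 ≤ P) (hα : 0 < α) :
    (Nat.card {n : ℕ | 1 ≤ n ∧ (n : ℝ) ≤ P ∧ ∀ p : ℕ, p.Prime → p ∣ n → p ∈ s} : ℝ) ≤
      P ^ α * ∏ p ∈ s with p.Prime, (1 - (p : ℝ) ^ (-α))⁻¹ := by
  set T : Set ℕ := {n : ℕ | 1 ≤ n ∧ (n : ℝ) ≤ P ∧ ∀ p : ℕ, p.Prime → p ∣ n → p ∈ s}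
  let f : ℕ →* ℝ :=
    { toFun := fun n => (n : ℝ) ^ (-α)
      map_one' := by simp
      map_mul' := fun m n => by
        rw [Nat.cast_mul, mul_rpow (Nat.cast_nonneg m) (Nat.cast_nonneg n)] }
  have hf : ∀ n, f n = (n : ℝ) ^ (-α) := fun n => rfl
  have hf0 : ∀ n, 0 ≤ f n := fun n => rpow_nonneg (Nat.cast_nonneg n) _
  obtain ⟨-, hsum⟩ := EulerProduct.summable_and_hasSum_factoredNumbers_prod_filter_prime_geometric
    (f := f) (fun {p} hp => by
      rw [norm_of_nonneg (hf0 p)]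
      exact rpow_lt_one_of_one_lt_of_neg (by exact_mod_cast hp.one_lt) (by linarith)) s
  have hfin : T.Finite := (Set.finite_Iic ⌊P⌋₊).subset fun n hn => Nat.le_floor hn.2.1
  have hmem : ∀ n ∈ T, n ∈ Nat.factoredNumbers s := fun n hn =>
    Nat.mem_factoredNumbers'.2 hn.2.2
  have hle : ∑ n ∈ hfin.toFinset, f n ≤ ∏ p ∈ s with p.Prime, (1 - f p)⁻¹ := by
    have := sum_le_hasSum (hfin.toFinset.subtype (· ∈ Nat.factoredNumbers s))
      (fun i _ => hf0 i) hsum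
    rwa [sum_subtype_of_mem (fun n => f n)
      (fun n hn => hmem n (hfin.mem_toFinset.1 hn))] at this
  have hcard : (Nat.card T : ℝ) ≤ P ^ α * ∑ n ∈ hfin.toFinset, f n := by
    rw [Nat.card_coe_set_eq, Set.ncard_eq_toFinset_card T hfin, mul_sum, card_eq_sum_ones]
    push_cast
    refine sum_le_sum fun n hn => ?_
    obtain ⟨h1, h2, -⟩ := hfin.mem_toFinset.1 hn
    have hn0 : (0 : ℝ) < n := by exact_mod_cast h1
    rw [hf, rpow_neg hn0.le, ← div_eq_mul_inv, one_le_div (rpow_pos_of_pos hn0 _)]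
    exact rpow_le_rpow hn0.le h2 hα.le
  exact hcard.trans (mul_le_mul_of_nonneg_left hle (rpow_nonneg hP _))

theorem log_five_and_half_gt : (1.7 : ℝ) < log 5.5 := by
  rw [lt_log_iff_exp_lt (by norm_num)]
  refine lt_of_pow_lt_pow_left₀ 10 (by norm_num) ?_
  rw [← exp_nat_mul, show ((10 : ℕ) : ℝ) * 1.7 = ((17 : ℕ) : ℝ) * 1 by norm_num, exp_nat_mul]
  calc exp 1 ^ 17 < 2.7182818286 ^ 17 := by gcongr; exact exp_one_lt_d9
    _ < 5.5 ^ 10 := by norm_num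

theorem euler_exponent_le {y : ℝ} (hy : 30.25 ≤ y) :
    log 4 * (2 * (y - √y) / log y + 2 * √y / (3 * log y)) / 0.9815 ≤ 2 * y / exp 1 := by
  obtain ⟨z, hz, rfl⟩ : ∃ z : ℝ, 5.5 ≤ z ∧ y = z ^ 2 :=
    ⟨√y, le_sqrt_of_sq_le (by norm_num; linarith), (sq_sqrt (by linarith)).symm⟩
  have hz0 : 0 < z := by linarith
  have hlogz : 2.7 - 5.5 / z ≤ log z := by
    have h := one_sub_inv_le_log_of_pos (show 0 < z / 5.5 by positivity)
    rw [log_div hz0.ne' (by norm_num), inv_div] at h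
    linarith [log_five_and_half_gt]
  have hl : 0 < log z := log_pos (by linarith)
  have hlog4 : log 4 ≤ 1.386295 := by
    rw [show (4 : ℝ) = 2 ^ 2 by norm_num, log_pow]
    push_cast
    linarith [log_two_lt_d9]
  rw [sqrt_sq hz0.le, log_pow]
  push_cast
  have hkey : 1.386295 * (z - 2 / 3) / 0.9815 * 2.7182818286 ≤ 2 * z * log z := by
    have h1 : z * (2.7 - 5.5 / z) ≤ z * log z := mul_le_mul_of_nonneg_left hlogz hz0.le
    rw [mul_sub, mul_div_cancel₀ _ hz0.ne'] at h1
    norm_num at h1 hz ⊢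
    linarith
  have hrw : 2 * (z ^ 2 - z) / (2 * log z) + 2 * z / (3 * (2 * log z)) =
      z * (z - 2 / 3) / log z := by
    field_simp
    ring
  rw [hrw, le_div_iff₀ (exp_pos 1)]
  have hnn : 0 ≤ z * (z - 2 / 3) / log z := div_nonneg (mul_nonneg hz0.le (by linarith)) hl.le
  calc log 4 * (z * (z - 2 / 3) / log z) / 0.9815 * exp 1
      ≤ 1.386295 * (z * (z - 2 / 3) / log z) / 0.9815 * 2.7182818286 := by
        gcongr
        exact exp_one_lt_d9.le
    _ = z / log z * (1.386295 * (z - 2 / 3) / 0.9815 * 2.7182818286) := by ring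
    _ ≤ z / log z * (2 * z * log z) := by gcongr
    _ = 2 * z ^ 2 := by field_simp

theorem prod_inv_one_sub_le_exp {s : Finset ℕ} {x : ℕ → ℝ} {c : ℝ} (hc : c < 1)
    (h0 : ∀ p ∈ s, 0 ≤ x p) (hx : ∀ p ∈ s, x p ≤ c) :
    ∏ p ∈ s, (1 - x p)⁻¹ ≤ exp ((∑ p ∈ s, x p) / (1 - c)) := by
  rw [sum_div, exp_sum]
  refine prod_le_prod (fun p hp => inv_nonneg.2 (by linarith [hx p hp])) fun p hp => ?_
  have h1 : 0 < 1 - x p := by linarith [hx p hp]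
  calc (1 - x p)⁻¹ = x p / (1 - x p) + 1 := by field_simp; ring
    _ ≤ exp (x p / (1 - x p)) := add_one_le_exp _
    _ ≤ exp (x p / (1 - c)) := exp_le_exp.2
        (div_le_div_of_nonneg_left (h0 p hp) (by linarith) (by linarith [hx p hp]))

/-- **Lemma 2.3, Ford**: if `R ≥ (2u)³ ≥ 90000`, then `|C(R^u, R)| ≤ R^u (2/u)^u`. -/
theorem CPR_card_upper_bound (u R : ℝ) (h₁ : (90000 : ℝ) ≤ (2 * u) ^ 3)
    (h₂ : (2 * u) ^ 3 ≤ R) :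
    (Nat.card (CPR (R ^ u) R) : ℝ) ≤ R ^ u * (2 / u) ^ u := by
  have hu : 22.4 ≤ u := by
    by_contra! h
    have h3 : (2 * u) ^ 3 < (2 * 22.4) ^ 3 :=
      Odd.strictMono_pow (by decide) (by linarith)
    norm_num at h3
    linarith
  have hu0 : 0 < u := by linarith
  have hR : 90000 ≤ R := h₁.trans h₂
  have hR0 : 0 < R := by linarith
  have he1 := exp_one_gt_d9
  have he2 := exp_one_lt_d9
  obtain ⟨y, hy⟩ : ∃ y, y = exp 1 * u / 2 := ⟨_, rfl⟩
  have hy30 : 30.25 ≤ y := by rw [hy]; nlinarith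
  have hy0 : 0 < y := by linarith
  have hyu : y ≤ 2 * u := by rw [hy]; nlinarith
  have hlogy : 0 < log y := log_pos (by linarith)
  have hlogR : 3 * log y ≤ log R := by
    have := log_le_log (by positivity) ((pow_le_pow_left₀ hy0.le hyu 3).trans h₂)
    rwa [log_pow] at this
  have hlogR0 : 0 < log R := by linarith
  obtain ⟨η, hη⟩ : ∃ η, η = log y / log R := ⟨_, rfl⟩
  have hη0 : 0 < η := by rw [hη]; positivity
  have hη1 : η < 1 := by rw [hη, div_lt_one hlogR0]; linarith
  have hRη : R ^ η = y := by
    rw [rpow_def_of_pos hR0, hη, mul_div_cancel₀ _ hlogR0.ne', exp_log hy0]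
  have hsη : (√R) ^ η = √y := by
    rw [← hRη, sqrt_eq_rpow, sqrt_eq_rpow, ← rpow_mul hR0.le, ← rpow_mul hR0.le, mul_comm]
  have hs0 : 0 < √R := sqrt_pos.2 hR0
  obtain ⟨s, hs⟩ : ∃ s, s = {p ∈ Ioc ⌊√R⌋₊ ⌊R⌋₊ | p.Prime} := ⟨_, rfl⟩
  have hgt : ∀ p ∈ s, √R < p := fun p hp => by
    rw [hs, mem_filter, mem_Ioc] at hp
    exact (Nat.floor_lt hs0.le).1 hp.1.1
  have hxle : ∀ p ∈ s, (p : ℝ) ^ (η - 1) ≤ 0.0185 := fun p hp => by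
    have hyR : √y ≤ 0.0185 * √R := by
      rw [sqrt_le_left (by positivity), mul_pow, sq_sqrt hR0.le]
      have hu2 : 22.4 ^ 2 * u ≤ u ^ 3 := by nlinarith [mul_nonneg hu0.le (sub_nonneg.2 hu)]
      rw [hy]
      nlinarith
    calc (p : ℝ) ^ (η - 1) ≤ (√R) ^ (η - 1) :=
          rpow_le_rpow_of_nonpos hs0 (hgt p hp).le (by linarith)
      _ = √y / √R := by rw [rpow_sub_one hs0.ne', hsη]
      _ ≤ 0.0185 := by rwa [div_le_iff₀ hs0]
  have hsum : ∑ p ∈ s, (p : ℝ) ^ (η - 1) ≤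
      log 4 * (2 * (y - √y) / log y + 2 * √y / (3 * log y)) := by
    have hp : ∀ p ∈ s, (p : ℝ) ^ (η - 1) ≤ 2 / log R * (log p * (p : ℝ) ^ (η - 1)) :=
      fun p hp => by
        have hl : log R / 2 ≤ log p := by
          rw [← log_sqrt hR0.le]
          exact log_le_log hs0 (hgt p hp).le
        rw [← mul_assoc]
        refine le_mul_of_one_le_left (rpow_nonneg (Nat.cast_nonneg p) _) ?_
        rw [div_mul_eq_mul_div, one_le_div hlogR0]
        linarith
    have hlog := sum_log_mul_rpow_sqrt_le hη0 hη1.le (by linarith : 4 ≤ R)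
    rw [hRη, hsη, ← hs] at hlog
    have hlog4 : 0 < log 4 := log_pos (by norm_num)
    calc ∑ p ∈ s, (p : ℝ) ^ (η - 1)
        ≤ 2 / log R * ∑ p ∈ s, log p * (p : ℝ) ^ (η - 1) := by
          rw [mul_sum]; exact sum_le_sum hp
      _ ≤ 2 / log R * (log 4 * ((y - √y) / η + √y)) := by gcongr
      _ = log 4 * (2 * (y - √y) / log y + 2 * √y / log R) := by
          rw [hη]; field_simp
      _ ≤ _ := by gcongr
  have hprod : ∏ p ∈ s, (1 - (p : ℝ) ^ (-(1 - η)))⁻¹ ≤ exp u := by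
    rw [neg_sub]
    refine (prod_inv_one_sub_le_exp (by norm_num : (0.0185 : ℝ) < 1)
      (fun p _ => rpow_nonneg (Nat.cast_nonneg p) _) hxle).trans (exp_le_exp.2 ?_)
    have hfinal := euler_exponent_le hy30
    have h2y : 2 * y / exp 1 = u := by rw [hy]; field_simp
    rw [h2y] at hfinal
    refine le_trans ?_ hfinal
    norm_num only
    gcongr
  have hset : CPR (R ^ u) R = {n : ℕ | 1 ≤ n ∧ (n : ℝ) ≤ R ^ u ∧
      ∀ p : ℕ, p.Prime → p ∣ n → p ∈ Ioc ⌊√R⌋₊ ⌊R⌋₊} := by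
    simp only [CPR, mem_Ioc, Nat.floor_lt hs0.le, Nat.le_floor_iff hR0.le]
  rw [hset]
  refine (card_le_rpow_mul_prod_inv _ (rpow_nonneg hR0.le u) (by linarith : 0 < 1 - η)).trans ?_
  rw [← hs]
  have hP : (R ^ u) ^ (1 - η) = R ^ u * (y ^ u)⁻¹ := by
    rw [← rpow_mul hR0.le, mul_one_sub, rpow_sub hR0, mul_comm u η, rpow_mul hR0.le, hRη,
      div_eq_mul_inv]
  have hexp : (y ^ u)⁻¹ * exp u = (2 / u) ^ u := by
    rw [← exp_one_rpow u, ← inv_rpow hy0.le, ← mul_rpow (inv_nonneg.2 hy0.le) (exp_pos 1).le]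
    congr 1
    rw [hy]
    field_simp
  rw [hP, ← hexp, mul_assoc]
  gcongr
end
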